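/- Perturbation lemma for the Lipschitz comparison principle (Lemma 3.8, corrected form). Assume the Hamiltonian H = (H^j) satisfies (H0), (H1) and the growth condition: there exists K > 0 such that |H^j(x,r,p) − H^j(x,s,q)| ≤ K(|r−s| + |p−q|) for all j ∈ J, x ∈ [0,l_j], r,s,p,q ∈ ℝ. Let β = (β_{ij}) with β_{ij} > 0 for every i ∈ I_T, j ∈ Inc_i, let ε > 0, and let w₁, w₂ ∈ C²(Γ) satisfy (CP). Then for every η > 0 there exists φ_η ∈ C²(Γ) with sup_Γ |φ_η| ≤ η and S^i_β φ_η > 0 for all i ∈ I_T, such that the function w̄_η := w₂ + φ_η satisfies, for all x ∈ [0,l_j] and j ∈ J, −ε ∂²_j w̄_η(x) + H^j(x, w̄_η(x), ∂_j w̄_η(x)) < −ε ∂²_j w₁(x) + H^j(x, w₁(x), ∂_j w₁(x)). -/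

import Mathlib

open Set

noncomputable section

/-- A finite connected topological network. -/
structure Network where
  I : Type
  J : Type
  finI : Fintype I
  finJ : Fintype J
  neI : Nonempty I
  neJ : Nonempty J
  l : J → ℝ
  l_pos : ∀ j, 0 < l j
  s : J → I
  t : J → I
  st_ne : ∀ j, s j ≠ t j
  conn : ∀ i i' : I,
    Relation.ReflTransGen (fun a b => ∃ j, (s j = a ∧ t j = b) ∨ (s j = b ∧ t j = a)) i i'
  IB : Set I
  IB_ne : IB.Nonempty
  deg_one_bd : ∀ i : I, ({j : J | s j = i ∨ t j = i} : Set J).ncard = 1 → i ∈ IB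

attribute [instance] Network.finI Network.finJ Network.neI Network.neJ

namespace Network

open scoped Classical

variable (N : Network)

/-- The set of edges incident to the vertex `i`. -/
def Inc (i : N.I) : Set N.J := {j | N.s j = i ∨ N.t j = i}

/-- The set of transition vertices. -/
def IT : Set N.I := N.IBᶜ

/-- The signed incidence `a_{ij}`. -/
def sgn (i : N.I) (j : N.J) : ℝ := if N.s j = i then 1 else -1

/-- The parameter `y_i^j` of the vertex `i` on the edge `j`. -/
def param (i : N.I) (j : N.J) : ℝ := if N.s j = i then 0 else N.l j

/-- The edge `j` as a parameter interval. -/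
def edge (j : N.J) : Set ℝ := Icc 0 (N.l j)

/-- A family `(u^j)` of functions on the edges defines a function on the network iff
the values at each vertex agree. -/
def Compat (u : N.J → ℝ → ℝ) : Prop :=
  ∀ i : N.I, ∀ j ∈ N.Inc i, ∀ k ∈ N.Inc i, u j (N.param i j) = u k (N.param i k)

/-- `u ∈ C(Γ)`. -/
def IsCont (u : N.J → ℝ → ℝ) : Prop :=
  N.Compat u ∧ ∀ j, ContinuousOn (u j) (N.edge j)

/-- `u ∈ C²(Γ)`. -/
def IsC2 (u : N.J → ℝ → ℝ) : Prop :=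
  N.Compat u ∧ ∀ j, ContDiffOn ℝ 2 (u j) (N.edge j)

/-- First derivative `∂_j u` along the edge `j`. -/
def pd (u : N.J → ℝ → ℝ) (j : N.J) (x : ℝ) : ℝ := derivWithin (u j) (N.edge j) x

/-- Second derivative `∂²_j u` along the edge `j`. -/
def pd2 (u : N.J → ℝ → ℝ) (j : N.J) (x : ℝ) : ℝ := derivWithin (N.pd u j) (N.edge j) x

/-- Sum over the edges incident to `i`. -/
def incSum (i : N.I) (f : N.J → ℝ) : ℝ := ∑ j : N.J, if j ∈ N.Inc i then f j else 0

/-- The Kirchhoff sum `S^i_β u`. -/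
def kir (β : N.I → N.J → ℝ) (u : N.J → ℝ → ℝ) (i : N.I) : ℝ :=
  N.incSum i (fun j => β i j * N.sgn i j * N.pd u j (N.param i j))

/-- `u ∈ C²_{*,β}(Γ)`. -/
def IsC2Star (β : N.I → N.J → ℝ) (u : N.J → ℝ → ℝ) : Prop :=
  N.IsC2 u ∧ ∀ i ∈ N.IT, N.kir β u i = 0

/-- (H0): continuity of each `H^j`. -/
def H0 (H : N.J → ℝ → ℝ → ℝ → ℝ) : Prop :=
  ∀ j, ContinuousOn (fun q : ℝ × ℝ × ℝ => H j q.1 q.2.1 q.2.2)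
    ((N.edge j) ×ˢ (univ : Set ℝ) ×ˢ (univ : Set ℝ))

/-- (H1): `r ↦ H^j(x,r,p)` is nondecreasing. -/
def H1 (H : N.J → ℝ → ℝ → ℝ → ℝ) : Prop :=
  ∀ j, ∀ x ∈ N.edge j, ∀ p : ℝ, Monotone fun r => H j x r p

/-- (H3): `p ↦ H^j(v_i,r,p)` is nondecreasing on `(0,∞)` at transition vertices. -/
def H3 (H : N.J → ℝ → ℝ → ℝ → ℝ) : Prop :=
  ∀ i ∈ N.IT, ∀ j ∈ N.Inc i, ∀ r : ℝ,
    MonotoneOn (fun p => H j (N.param i j) r p) (Ioi (0 : ℝ))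

/-- (H4): coercivity in `p`, uniform on bounded `r`-sets. -/
def H4 (H : N.J → ℝ → ℝ → ℝ → ℝ) : Prop :=
  ∀ j, ∀ R : ℝ, 0 < R → ∀ A : ℝ, ∃ M : ℝ, ∀ x ∈ N.edge j, ∀ r : ℝ, |r| ≤ R →
    ∀ p : ℝ, M < |p| → A < H j x r p

/-- (H5): continuity of `H` at the transition vertices. -/
def H5 (H : N.J → ℝ → ℝ → ℝ → ℝ) : Prop :=
  ∀ i ∈ N.IT, ∀ j ∈ N.Inc i, ∀ k ∈ N.Inc i, ∀ r p : ℝ,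
    H j (N.param i j) r p = H k (N.param i k) r p

/-- (H6): symmetry of `H` in `p` at the transition vertices. -/
def H6 (H : N.J → ℝ → ℝ → ℝ → ℝ) : Prop :=
  ∀ i ∈ N.IT, ∀ j ∈ N.Inc i, ∀ r p : ℝ,
    H j (N.param i j) r p = H j (N.param i j) r (-p)

end Network

/-- The hypotheses (CP) of the comparison principles: `w₁` is a supersolution and `w₂` a
subsolution of the viscous equation, the Kirchhoff sums are ordered, and the boundary
values are ordered. -/
def Network.CP (N : Network) (H : N.J → ℝ → ℝ → ℝ → ℝ) (β : N.I → N.J → ℝ) (ε : ℝ)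
    (w₁ w₂ : N.J → ℝ → ℝ) : Prop :=
  (∀ j, ∀ x ∈ N.edge j,
    -ε * N.pd2 w₂ j x + H j x (w₂ j x) (N.pd w₂ j x) ≤
      -ε * N.pd2 w₁ j x + H j x (w₁ j x) (N.pd w₁ j x)) ∧
  (∀ i ∈ N.IT, N.kir β w₁ i ≤ N.kir β w₂ i) ∧
  (∀ i ∈ N.IB, ∀ j ∈ N.Inc i, w₂ j (N.param i j) ≤ w₁ j (N.param i j))

namespace Network

open scoped Classical

/-- The endpoint of the edge `j` other than `i`. -/
def opp (N : Network) (i : N.I) (j : N.J) : N.I := if N.s j = i then N.t j else N.s j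

/-- The graph on the vertices whose adjacency is being joined by an edge. -/
def graph (N : Network) : SimpleGraph N.I where
  Adj a b := ∃ j, (N.s j = a ∧ N.t j = b) ∨ (N.s j = b ∧ N.t j = a)
  symm := ⟨fun _ _ ⟨j, h⟩ => ⟨j, h.symm⟩⟩
  loopless := ⟨fun _ ⟨j, h⟩ => N.st_ne j (by
    rcases h with ⟨h₁, h₂⟩ | ⟨h₁, h₂⟩ <;> exact h₁.trans h₂.symm)⟩

theorem exists_injective_rank (N : Network) (i₀ : N.I) :
    ∃ r : N.I → ℕ, Function.Injective r ∧
      ∀ i, i ≠ i₀ → ∃ j ∈ N.Inc i, r (N.opp i j) < r i := by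
  set n := Fintype.card N.I
  let e := Fintype.equivFin N.I
  have he : ∀ i, (e i : ℕ) < n := fun i => (e i).2
  refine ⟨fun i => n * N.graph.dist i i₀ + e i, fun a b hab => ?_, fun i hi => ?_⟩
  · have := congrArg (· % n) hab
    simp only [Nat.mul_add_mod, Nat.mod_eq_of_lt (he _)] at this
    exact e.injective (Fin.ext this)
  · have hr : N.graph.Reachable i i₀ :=
      (SimpleGraph.reachable_iff_reflTransGen _ _).2 (N.conn i i₀)
    obtain ⟨p, hp⟩ := hr.exists_walk_length_eq_dist
    cases p with
    | nil => exact absurd rfl hi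
    | cons hadj q =>
      rename_i v
      have hd : N.graph.dist v i₀ + 1 ≤ N.graph.dist i i₀ := by
        rw [← hp, SimpleGraph.Walk.length_cons]
        exact Nat.succ_le_succ (SimpleGraph.dist_le q)
      have hlt : n * N.graph.dist v i₀ + e v < n * N.graph.dist i i₀ + e i := by
        have := Nat.mul_le_mul_left n hd
        have := he v
        rw [Nat.mul_add] at *
        omega
      obtain ⟨j, ⟨h₁, h₂⟩ | ⟨h₁, h₂⟩⟩ := hadj
      · refine ⟨j, Or.inl h₁, ?_⟩
        have : N.opp i j = v := by simp [opp, h₁, h₂]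
        simpa only [this] using hlt
      · refine ⟨j, Or.inr h₂, ?_⟩
        have hne : N.s j ≠ i := fun h => N.st_ne j (h.trans h₂.symm)
        have : N.opp i j = v := by rw [opp, if_neg hne, h₁]
        simpa only [this] using hlt

/-- The profile `(e^{μx} - 1) / (e^{μl} - 1)`, which increases from `0` to `1` on `[0, l]`. -/
def profile (μ l x : ℝ) : ℝ := (Real.exp (μ * x) - 1) / (Real.exp (μ * l) - 1)

/-- The derivative of `profile`. -/
def profileDeriv (μ l x : ℝ) : ℝ := μ * Real.exp (μ * x) / (Real.exp (μ * l) - 1)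

theorem div_exp_sub_one_pos {μ l : ℝ} (hμ : μ ≠ 0) (hl : 0 < l) :
    0 < μ / (Real.exp (μ * l) - 1) := by
  rcases lt_or_gt_of_ne hμ with h | h
  · exact div_pos_of_neg_of_neg h (sub_neg.2 (Real.exp_lt_one_iff.2 (mul_neg_of_neg_of_pos h hl)))
  · exact div_pos h (sub_pos.2 (Real.one_lt_exp_iff.2 (mul_pos h hl)))

theorem profileDeriv_pos {μ l : ℝ} (hμ : μ ≠ 0) (hl : 0 < l) (x : ℝ) :
    0 < profileDeriv μ l x := by
  rw [profileDeriv, mul_div_right_comm]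
  exact mul_pos (div_exp_sub_one_pos hμ hl) (Real.exp_pos _)

theorem hasDerivAt_profile (μ l x : ℝ) :
    HasDerivAt (profile μ l) (profileDeriv μ l x) x := by
  have h := ((((hasDerivAt_id x).const_mul μ).exp).sub_const 1).div_const (Real.exp (μ * l) - 1)
  refine h.congr_deriv ?_
  simp only [profileDeriv, id]
  ring

theorem hasDerivAt_profileDeriv (μ l x : ℝ) :
    HasDerivAt (profileDeriv μ l) (μ * profileDeriv μ l x) x := by
  have h := ((((hasDerivAt_id x).const_mul μ).exp).const_mul μ).div_const (Real.exp (μ * l) - 1)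
  refine h.congr_deriv ?_
  simp only [profileDeriv, id]
  ring

theorem profile_zero (μ l : ℝ) : profile μ l 0 = 0 := by simp [profile]

theorem profile_right {μ l : ℝ} (hμ : μ ≠ 0) (hl : 0 < l) : profile μ l l = 1 :=
  div_self fun h => by simpa [h] using div_exp_sub_one_pos hμ hl

theorem profile_mem_Icc {μ l x : ℝ} (hμ : μ ≠ 0) (hl : 0 < l) (hx : x ∈ Icc 0 l) :
    profile μ l x ∈ Icc (0 : ℝ) 1 := by
  have hm : StrictMono (profile μ l) := strictMono_of_hasDerivAt_pos
    (fun y => hasDerivAt_profile μ l y) (fun y => profileDeriv_pos hμ hl y)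
  exact ⟨profile_zero μ l ▸ hm.monotone hx.1, profile_right hμ hl ▸ hm.monotone hx.2⟩

/-- The function with vertex values `c` that on each edge `j` interpolates by `profile (μ j)`. -/
def interp (N : Network) (c : N.I → ℝ) (μ : N.J → ℝ) (j : N.J) (x : ℝ) : ℝ :=
  c (N.s j) + (c (N.t j) - c (N.s j)) * profile (μ j) (N.l j) x

theorem interp_param {N : Network} (c : N.I → ℝ) {μ : N.J → ℝ} (hμ : ∀ j, μ j ≠ 0)
    {i : N.I} {j : N.J} (hj : j ∈ N.Inc i) : N.interp c μ j (N.param i j) = c i := by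
  by_cases h : N.s j = i
  · simp [interp, param, h, profile_zero]
  · have ht : N.t j = i := hj.resolve_left h
    simp [interp, param, h, profile_right (hμ j) (N.l_pos j), ht]

theorem isC2_interp {N : Network} (c : N.I → ℝ) {μ : N.J → ℝ} (hμ : ∀ j, μ j ≠ 0) :
    N.IsC2 (N.interp c μ) := by
  refine ⟨fun i j hj k hk => by rw [interp_param c hμ hj, interp_param c hμ hk], fun j => ?_⟩
  unfold interp profile
  fun_prop

theorem uniqueDiffOn_edge (N : Network) (j : N.J) : UniqueDiffOn ℝ (N.edge j) :=
  uniqueDiffOn_Icc (N.l_pos j)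

theorem pd_interp {N : Network} (c : N.I → ℝ) (μ : N.J → ℝ) {j : N.J} {x : ℝ}
    (hx : x ∈ N.edge j) :
    N.pd (N.interp c μ) j x =
      (c (N.t j) - c (N.s j)) * profileDeriv (μ j) (N.l j) x :=
  (((hasDerivAt_profile (μ j) (N.l j) x).const_mul _).const_add _).hasDerivWithinAt.derivWithin
    (N.uniqueDiffOn_edge j x hx)

theorem pd2_interp {N : Network} (c : N.I → ℝ) (μ : N.J → ℝ) {j : N.J} {x : ℝ}
    (hx : x ∈ N.edge j) :
    N.pd2 (N.interp c μ) j x = μ j * N.pd (N.interp c μ) j x := by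
  rw [pd2, derivWithin_congr (fun y hy => pd_interp c μ hy) (pd_interp c μ hx),
    ((hasDerivAt_profileDeriv (μ j) (N.l j) x).const_mul _).hasDerivWithinAt.derivWithin
      (N.uniqueDiffOn_edge j x hx), pd_interp c μ hx]
  ring

theorem pd_add {N : Network} {u v : N.J → ℝ → ℝ} (hu : N.IsC2 u) (hv : N.IsC2 v) {j : N.J}
    {x : ℝ} (hx : x ∈ N.edge j) :
    N.pd (fun m y => u m y + v m y) j x = N.pd u j x + N.pd v j x :=
  derivWithin_fun_add ((hu.2 j).differentiableOn (by norm_num) x hx)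
    ((hv.2 j).differentiableOn (by norm_num) x hx)

theorem differentiableOn_pd {N : Network} {u : N.J → ℝ → ℝ} (hu : N.IsC2 u) (j : N.J) :
    DifferentiableOn ℝ (N.pd u j) (N.edge j) :=
  ((hu.2 j).derivWithin (m := 1) (N.uniqueDiffOn_edge j) (by norm_num)).differentiableOn
    (by norm_num)

theorem pd2_add {N : Network} {u v : N.J → ℝ → ℝ} (hu : N.IsC2 u) (hv : N.IsC2 v) {j : N.J}
    {x : ℝ} (hx : x ∈ N.edge j) :
    N.pd2 (fun m y => u m y + v m y) j x = N.pd2 u j x + N.pd2 v j x := by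
  rw [pd2, derivWithin_congr (fun y hy => pd_add hu hv hy) (pd_add hu hv hx)]
  exact derivWithin_fun_add (differentiableOn_pd hu j x hx) (differentiableOn_pd hv j x hx)

theorem param_mem_edge (N : Network) (i : N.I) (j : N.J) : N.param i j ∈ N.edge j := by
  have := (N.l_pos j).le
  unfold param edge
  split_ifs <;> simp [this]

theorem sgn_mul_pd_interp {N : Network} (c : N.I → ℝ) (μ : N.J → ℝ) {i : N.I} {j : N.J}
    (hj : j ∈ N.Inc i) :
    N.sgn i j * N.pd (N.interp c μ) j (N.param i j) =
      (c (N.opp i j) - c i) * profileDeriv (μ j) (N.l j) (N.param i j) := by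
  rw [pd_interp c μ (N.param_mem_edge i j)]
  by_cases h : N.s j = i
  · simp [sgn, opp, h]
  · have ht : N.t j = i := hj.resolve_left h
    simp only [sgn, opp, h, if_false, ht]
    ring

/-- If every transition vertex has a neighbour of smaller rank, then the function with vertex
values `η (θ ^ rank - 1)` has positive Kirchhoff sums for small `θ`. -/
theorem exists_kir_interp_pos {N : Network} {β : N.I → N.J → ℝ}
    (hβ : ∀ i ∈ N.IT, ∀ j ∈ N.Inc i, 0 < β i j) {μ : N.J → ℝ} (hμ : ∀ j, μ j ≠ 0)
    {r : N.I → ℕ} (hr : ∀ i ∈ N.IT, ∃ j ∈ N.Inc i, r (N.opp i j) < r i) {η : ℝ} (hη : 0 < η) :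
    ∃ θ : ℝ, 0 < θ ∧ θ < 1 ∧
      ∀ i ∈ N.IT, 0 < N.kir β (N.interp (fun i => η * (θ ^ r i - 1)) μ) i := by
  have hg : ∀ i j, 0 < profileDeriv (μ j) (N.l j) (N.param i j) :=
    fun i j => profileDeriv_pos (hμ j) (N.l_pos j) _
  let b : N.I → N.J → ℝ := fun i j =>
    if j ∈ N.Inc i then β i j * profileDeriv (μ j) (N.l j) (N.param i j) else 0
  have hb : ∀ i ∈ N.IT, ∀ j, 0 ≤ b i j := fun i hi j => by
    simp only [b]
    split_ifs with h
    · exact (mul_pos (hβ i hi j h) (hg i j)).le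
    · exact le_rfl
  have key : ∀ᶠ θ : ℝ in nhdsWithin 0 (Ioi 0), ∀ i ∈ N.IT, ∀ j ∈ N.Inc i,
      (∑ k, b i k) * θ < b i j := by
    simp only [Filter.eventually_all]
    intro i hi j hj
    have hpos : 0 < b i j := by
      simpa only [b, if_pos hj] using mul_pos (hβ i hi j hj) (hg i j)
    have hc : Filter.Tendsto (fun θ : ℝ => (∑ k, b i k) * θ) (nhds 0) (nhds 0) := by
      simpa using (continuous_const_mul (∑ k, b i k)).tendsto (0 : ℝ)
    exact (hc.mono_left nhdsWithin_le_nhds).eventually_lt_const hpos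
  have hone : ∀ᶠ θ : ℝ in nhdsWithin 0 (Ioi 0), θ < 1 :=
    nhdsWithin_le_nhds (Iio_mem_nhds one_pos)
  obtain ⟨θ, ⟨hkey, hθ1⟩, hθ0⟩ := ((key.and hone).and self_mem_nhdsWithin).exists
  replace hθ0 : 0 < θ := hθ0
  refine ⟨θ, hθ0, hθ1, fun i hi => ?_⟩
  obtain ⟨j₀, hj₀, hlt⟩ := hr i hi
  have hkir : N.kir β (N.interp (fun i => η * (θ ^ r i - 1)) μ) i =
      η * (∑ j, b i j * θ ^ r (N.opp i j) - (∑ j, b i j) * θ ^ r i) := by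
    rw [kir, incSum, Finset.sum_mul, ← Finset.sum_sub_distrib, Finset.mul_sum]
    refine Finset.sum_congr rfl fun j _ => ?_
    simp only [b]
    split_ifs with h
    · rw [mul_assoc, sgn_mul_pd_interp _ _ h]
      ring
    · ring
  rw [hkir]
  refine mul_pos hη (sub_pos.2 ?_)
  calc (∑ j, b i j) * θ ^ r i
      ≤ (∑ j, b i j) * (θ * θ ^ r (N.opp i j₀)) := by
        refine mul_le_mul_of_nonneg_left ?_ (Finset.sum_nonneg fun j _ => hb i hi j)
        rw [← pow_succ']
        exact pow_le_pow_of_le_one hθ0.le hθ1.le hlt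
    _ = ((∑ j, b i j) * θ) * θ ^ r (N.opp i j₀) := by ring
    _ < b i j₀ * θ ^ r (N.opp i j₀) :=
        mul_lt_mul_of_pos_right (hkey i hi j₀ hj₀) (pow_pos hθ0 _)
    _ ≤ ∑ j, b i j * θ ^ r (N.opp i j) :=
        Finset.single_le_sum (f := fun j => b i j * θ ^ r (N.opp i j))
          (fun j _ => mul_nonneg (hb i hi j) (pow_pos hθ0 _).le) (Finset.mem_univ j₀)

end Network

open Network in
/-- **Lemma 3.8** (perturbation lemma for the Lipschitz comparison principle). -/
theorem perturbation_lemma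
    (N : Network) (H : N.J → ℝ → ℝ → ℝ → ℝ)
    (hH0 : N.H0 H) (hH1 : N.H1 H)
    (hLip : ∃ K > 0, ∀ j, ∀ x ∈ N.edge j, ∀ r s p q : ℝ,
      |H j x r p - H j x s q| ≤ K * (|r - s| + |p - q|))
    (β : N.I → N.J → ℝ)
    (hβ : ∀ i ∈ N.IT, ∀ j ∈ N.Inc i, 0 < β i j)
    (ε : ℝ) (hε : 0 < ε)
    (w₁ w₂ : N.J → ℝ → ℝ) (hw₁ : N.IsC2 w₁) (hw₂ : N.IsC2 w₂)
    (hCP : N.CP H β ε w₁ w₂) :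
    ∀ η : ℝ, 0 < η → ∃ φ : N.J → ℝ → ℝ, N.IsC2 φ ∧
      (∀ j, ∀ x ∈ N.edge j, |φ j x| ≤ η) ∧
      (∀ i ∈ N.IT, 0 < N.kir β φ i) ∧
      (∀ j, ∀ x ∈ N.edge j,
        -ε * N.pd2 (fun m y => w₂ m y + φ m y) j x
            + H j x (w₂ j x + φ j x) (N.pd (fun m y => w₂ m y + φ m y) j x)
          < -ε * N.pd2 w₁ j x + H j x (w₁ j x) (N.pd w₁ j x)) := by
  intro η hη
  obtain ⟨K, hK, hLip⟩ := hLip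
  obtain ⟨i₀, hi₀⟩ := N.IB_ne
  obtain ⟨r, hinj, hr⟩ := N.exists_injective_rank i₀
  set L : ℝ := K / ε + 1
  have hL : 0 < L := by positivity
  have hεL : K < ε * L := by
    have : ε * L = K + ε := by simp only [L]; field_simp
    linarith
  let μ : N.J → ℝ := fun j => if r (N.t j) < r (N.s j) then L else -L
  have hμ : ∀ j, μ j ≠ 0 := fun j => by
    simp only [μ]
    split_ifs
    · exact hL.ne'
    · exact neg_ne_zero.2 hL.ne'
  obtain ⟨θ, hθ0, hθ1, hkir⟩ := exists_kir_interp_pos hβ hμ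
    (fun i hi => hr i fun h => hi (h ▸ hi₀)) hη
  set c : N.I → ℝ := fun i => η * (θ ^ r i - 1) with hc
  have hc_mem : ∀ i, c i ∈ Icc (-η) 0 := fun i => by
    have h0 := pow_pos hθ0 (r i)
    have h1 := pow_le_one₀ (n := r i) hθ0.le hθ1.le
    constructor <;> simp only [hc] <;> nlinarith
  have hφ_mem : ∀ j, ∀ x ∈ N.edge j, N.interp c μ j x ∈ Icc (-η) 0 := fun j x hx => by
    obtain ⟨h0, h1⟩ := profile_mem_Icc (hμ j) (N.l_pos j) hx
    have := (convex_Icc (-η) 0) (hc_mem (N.s j)) (hc_mem (N.t j)) (sub_nonneg.2 h1) h0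
      (sub_add_cancel _ _)
    convert this using 1
    simp only [interp, smul_eq_mul]
    ring
  have hφ2 : N.IsC2 (N.interp c μ) := isC2_interp c hμ
  refine ⟨N.interp c μ, hφ2, fun j x hx => abs_le.2 ⟨(hφ_mem j x hx).1,
    (hφ_mem j x hx).2.trans hη.le⟩, hkir, fun j x hx => ?_⟩
  rw [pd2_add hw₂ hφ2 hx, pd_add hw₂ hφ2 hx]
  have hpd := pd_interp c μ hx
  have hg := profileDeriv_pos (hμ j) (N.l_pos j) x
  have hconv : N.pd2 (N.interp c μ) j x = L * |N.pd (N.interp c μ) j x| ∧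
      0 < |N.pd (N.interp c μ) j x| := by
    rw [pd2_interp c μ hx]
    rcases lt_or_gt_of_ne (hinj.ne (N.st_ne j)) with h | h
    · have hlt : c (N.t j) < c (N.s j) := by
        have := pow_lt_pow_right_of_lt_one₀ hθ0 hθ1 h
        simp only [hc]
        nlinarith
      have hneg : N.pd (N.interp c μ) j x < 0 := by
        rw [hpd]
        exact mul_neg_of_neg_of_pos (sub_neg.2 hlt) hg
      rw [abs_of_neg hneg]
      simp only [μ, if_neg h.not_gt]
      exact ⟨by ring, neg_pos.2 hneg⟩
    · have hlt : c (N.s j) < c (N.t j) := by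
        have := pow_lt_pow_right_of_lt_one₀ hθ0 hθ1 h
        simp only [hc]
        nlinarith
      have hpos : 0 < N.pd (N.interp c μ) j x := by
        rw [hpd]
        exact mul_pos (sub_pos.2 hlt) hg
      rw [abs_of_pos hpos]
      simp only [μ, if_pos h]
      exact ⟨trivial, hpos⟩
  have hmono : H j x (w₂ j x + N.interp c μ j x) (N.pd w₂ j x + N.pd (N.interp c μ) j x) ≤
      H j x (w₂ j x) (N.pd w₂ j x + N.pd (N.interp c μ) j x) :=
    hH1 j x hx _ (add_le_of_nonpos_right (hφ_mem j x hx).2)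
  have hl := (abs_le.1 (hLip j x hx (w₂ j x) (w₂ j x)
    (N.pd w₂ j x + N.pd (N.interp c μ) j x) (N.pd w₂ j x))).2
  rw [sub_self, abs_zero, zero_add, add_sub_cancel_left] at hl
  have hlt := mul_lt_mul_of_pos_right hεL hconv.2
  have := hCP.1 j x hx
  rw [hconv.1]
  linarith
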